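/- Let θ_0 > 0, 0 < θ_1 < 1, κ, c > 0, let Φ be the standard normal distribution function, let F_L be the standard Laplace distribution function, and let F_∞ be a continuous distribution function on ℝ satisfying 1 − F_∞(x) = F_∞(−x) for all x and 1 − F_∞(x) asymptotically equivalent to c x^{−κ} as x ↑ ∞. Define the ARCH(1) transition kernel in standard Laplace margins π(x,y) = Φ( F_∞^{←}(F_L(y)) / (θ_0 + θ_1 (F_∞^{←}(F_L(x)))²)^{1/2} ). Then for every y ∈ ℝ: (i) lim_{v→+∞} π(v, v + y) = 0.5 + 0.5 G_+(y) and lim_{v→−∞} π(v, v + y) = 0.5 G_−(y); (ii) lim_{v→+∞} π(v, −v + y) = 0.5 G_−(y) and lim_{v→−∞} π(v, −v + y) = 0.5 + 0.5 G_+(y); where G_+(y) = 2Φ(e^{y/κ}/√θ_1) − 1 and G_−(y) = 2Φ(−e^{−y/κ}/√θ_1). Equivalently, π(v, v+dx) converges weakly on the extended real line to K_+ = 0.5(δ_{−∞} + G_+) as v ↑ +∞ and to K_− = 0.5(G_− + δ_{+∞}) as v ↓ −∞, and π(v, −v+dx) converges to K_− as v ↑ +∞ and to K_+ as v ↓ −∞.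 -/

import Mathlib

open Filter Topology

/-- The standard normal distribution function `Φ`. -/
noncomputable def stdNormalCDF (x : ℝ) : ℝ :=
  ∫ t in Set.Iic x, Real.exp (-t ^ 2 / 2) / Real.sqrt (2 * Real.pi)

/-- The standard Laplace distribution function. -/
noncomputable def laplaceCDF (x : ℝ) : ℝ :=
  if x < 0 then Real.exp x / 2 else 1 - Real.exp (-x) / 2

/-- The generalized inverse `F^{←}(p) = inf{x : p ≤ F(x)}` of a distribution function. -/
noncomputable def genInv (F : ℝ → ℝ) (p : ℝ) : ℝ :=
  sInf {x : ℝ | p ≤ F x}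

/-- The ARCH(1) transition kernel in standard Laplace margins,
`π(x,y) = Φ(F_∞^{←}(F_L(y)) / (θ₀ + θ₁ (F_∞^{←}(F_L(x)))²)^{1/2})`. -/
noncomputable def archKernel (θ0 θ1 : ℝ) (Finf : ℝ → ℝ) (x y : ℝ) : ℝ :=
  stdNormalCDF (genInv Finf (laplaceCDF y)
    / Real.sqrt (θ0 + θ1 * (genInv Finf (laplaceCDF x)) ^ 2))

/-- The limit distribution function `G₊(y) = 2Φ(e^{y/κ}/√θ₁) - 1`. -/
noncomputable def archGplus (θ1 κ : ℝ) (y : ℝ) : ℝ :=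
  2 * stdNormalCDF (Real.exp (y / κ) / Real.sqrt θ1) - 1

/-- The limit distribution function `G₋(y) = 2Φ(-e^{-y/κ}/√θ₁)`. -/
noncomputable def archGminus (θ1 κ : ℝ) (y : ℝ) : ℝ :=
  2 * stdNormalCDF (-Real.exp (-y / κ) / Real.sqrt θ1)

theorem continuous_stdNormalCDF : Continuous stdNormalCDF := by
  have hint : MeasureTheory.Integrable
      (fun t : ℝ => Real.exp (-t ^ 2 / 2) / Real.sqrt (2 * Real.pi)) := by
    refine MeasureTheory.Integrable.div_const ?_ _
    convert integrable_exp_neg_mul_sq (show (0 : ℝ) < 1 / 2 by norm_num) using 3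
    ring
  have heq : stdNormalCDF = fun x => stdNormalCDF 0 +
      ∫ t in (0 : ℝ)..x, Real.exp (-t ^ 2 / 2) / Real.sqrt (2 * Real.pi) := by
    funext x
    rw [← intervalIntegral.integral_Iic_sub_Iic hint.integrableOn hint.integrableOn]
    simp only [stdNormalCDF]
    ring
  rw [heq]
  exact continuous_const.add
    (intervalIntegral.continuous_primitive (fun a b => hint.intervalIntegrable) 0)

theorem laplaceCDF_pos (u : ℝ) : 0 < laplaceCDF u := by
  unfold laplaceCDF
  split_ifs with h
  · positivity
  · have : Real.exp (-u) ≤ 1 := Real.exp_le_one_iff.mpr (by linarith)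
    linarith

theorem one_sub_laplaceCDF (u : ℝ) : 1 - laplaceCDF u = laplaceCDF (-u) := by
  unfold laplaceCDF
  rcases lt_trichotomy u 0 with h | h | h
  · rw [if_pos h, if_neg (by linarith), neg_neg]
  · subst h
    norm_num
  · rw [if_neg (by linarith), if_pos (by linarith)]
    ring

theorem laplaceCDF_lt_one (u : ℝ) : laplaceCDF u < 1 := by
  linarith [one_sub_laplaceCDF u, laplaceCDF_pos (-u)]

/-- A continuous distribution function takes the value `p` at its `p`-quantile. -/
theorem apply_genInv {F : ℝ → ℝ} (hcont : Continuous F) (hmono : Monotone F)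
    (htop : Tendsto F atTop (𝓝 1)) (hbot : Tendsto F atBot (𝓝 0)) {p : ℝ}
    (hp0 : 0 < p) (hp1 : p < 1) : F (genInv F p) = p := by
  have hne : {x : ℝ | p ≤ F x}.Nonempty := (htop.eventually (eventually_ge_nhds hp1)).exists
  obtain ⟨b, hb⟩ := (hbot.eventually (eventually_lt_nhds hp0)).exists
  have hbdd : BddBelow {x : ℝ | p ≤ F x} :=
    ⟨b, fun x hx => le_of_not_gt fun hxb => absurd (hmono hxb.le) (by
      have : p ≤ F x := hx
      linarith)⟩
  have hmem : p ≤ F (genInv F p) :=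
    (isClosed_le continuous_const hcont).csInf_mem hne hbdd
  refine le_antisymm ?_ hmem
  refine le_of_tendsto (hcont.continuousAt.tendsto.mono_left nhdsWithin_le_nhds :
    Tendsto F (𝓝[<] (genInv F p)) (𝓝 (F (genInv F p)))) ?_
  filter_upwards [self_mem_nhdsWithin] with x hx
  by_contra h
  exact absurd (csInf_le hbdd (show p ≤ F x by linarith)) (not_le.mpr hx)

/-- If `F` has a Pareto tail of index `κ` and `R` transports the Laplace distribution function
to `F`, then `R u` is asymptotic to `(2 c) ^ (1 / κ) * exp (u / κ)`. -/
theorem tendsto_transport_mul_exp {κ c : ℝ} (hκ : 0 < κ) (hc : 0 < c) {F : ℝ → ℝ}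
    (hmono : Monotone F)
    (htail : Tendsto (fun x => (1 - F x) / (c * x ^ (-κ))) atTop (𝓝 1))
    {R : ℝ → ℝ} (hR : ∀ u, F (R u) = laplaceCDF u) :
    Tendsto (fun u => R u * Real.exp (-u / κ)) atTop (𝓝 ((2 * c) ^ (1 / κ))) := by
  have hlt : ∀ M, F M < 1 := by
    intro M
    obtain ⟨x, hx, hxM, hx0⟩ := ((htail.eventually (eventually_gt_nhds one_pos)).and
      ((eventually_ge_atTop M).and (eventually_gt_atTop 0))).exists
    have hden : 0 < c * x ^ (-κ) := mul_pos hc (Real.rpow_pos_of_pos hx0 _)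
    have : 0 < 1 - F x := (div_pos_iff_of_pos_right hden).mp hx
    linarith [hmono hxM]
  have hL : Tendsto laplaceCDF atTop (𝓝 1) := by
    have h1 : Tendsto (fun u : ℝ => 1 - Real.exp (-u) / 2) atTop (𝓝 (1 - 0 / 2)) :=
      (Real.tendsto_exp_neg_atTop_nhds_zero.div_const 2).const_sub 1
    rw [zero_div, sub_zero] at h1
    refine h1.congr' ?_
    filter_upwards [eventually_ge_atTop 0] with u hu
    rw [laplaceCDF, if_neg (not_lt.mpr hu)]
  have hRtop : Tendsto R atTop atTop := by
    refine tendsto_atTop.mpr fun M => ?_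
    filter_upwards [hL.eventually (eventually_gt_nhds (hlt M))] with u hu
    by_contra h
    have := hmono (not_le.mp h).le
    rw [hR] at this
    linarith
  have h2 := (((htail.comp hRtop).mul_const (2 * c)).rpow_const
    (p := 1 / κ) (Or.inr (by positivity)))
  rw [one_mul] at h2
  refine h2.congr' ?_
  filter_upwards [eventually_ge_atTop 0, hRtop.eventually_gt_atTop 0] with u hu hRu
  have hval : (1 - F (R u)) / (c * R u ^ (-κ)) * (2 * c) = R u ^ κ * Real.exp (-u) := by
    rw [hR, laplaceCDF, if_neg (not_lt.mpr hu), Real.rpow_neg hRu.le]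
    have := Real.rpow_pos_of_pos hRu κ
    field_simp
    ring
  simp only [Function.comp_apply]
  rw [hval, Real.mul_rpow (by positivity) (by positivity), ← Real.rpow_mul hRu.le,
    mul_one_div_cancel hκ.ne', Real.rpow_one, ← Real.exp_mul, mul_one_div]

theorem tendsto_div_sqrt_add_mul_sq {α : Type*} {l : Filter α} {a b n d : ℝ}
    (hb : 0 < b) (hd : d ≠ 0) {N D r : α → ℝ} (hr : ∀ v, 0 < r v) (hr0 : Tendsto r l (𝓝 0))
    (hN : Tendsto (fun v => N v * r v) l (𝓝 n)) (hD : Tendsto (fun v => D v * r v) l (𝓝 d)) :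
    Tendsto (fun v => N v / Real.sqrt (a + b * D v ^ 2)) l (𝓝 (n / (Real.sqrt b * |d|))) := by
  have hS : Tendsto (fun v => Real.sqrt (a * r v ^ 2 + b * (D v * r v) ^ 2)) l
      (𝓝 (Real.sqrt b * |d|)) := by
    have := (((hr0.pow 2).const_mul a).add ((hD.pow 2).const_mul b)).sqrt
    rwa [zero_pow two_ne_zero, mul_zero, zero_add, Real.sqrt_mul hb.le, Real.sqrt_sq_eq_abs]
      at this
  refine (hN.div hS (by positivity)).congr fun v => ?_
  have : a * r v ^ 2 + b * (D v * r v) ^ 2 = (a + b * D v ^ 2) * r v ^ 2 := by ring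
  simp only [Pi.div_apply]
  rw [this, Real.sqrt_mul' _ (sq_nonneg _), Real.sqrt_sq (hr v).le,
    mul_div_mul_right _ _ (hr v).ne']

/-- Example 8 (ARCH(1) with Laplace margins): if the stationary distribution `F_∞` is a
continuous, symmetric distribution function with Pareto-type tails
`1 - F_∞(x) ≍ c x^{-κ}`, then the ARCH kernel in Laplace margins converges with two
distinct normalizations: for every `y ∈ ℝ`,
(i) `π(v, v+y) → 0.5 + 0.5G₊(y)` as `v → +∞` and `π(v, v+y) → 0.5G₋(y)` as `v → -∞`;
(ii) `π(v, -v+y) → 0.5G₋(y)` as `v → +∞` and `π(v, -v+y) → 0.5 + 0.5G₊(y)` as `v → -∞`.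
Equivalently `π(v, v+dx) ⇒ K₊ = 0.5(δ_{-∞} + G₊)` as `v ↑ +∞`, `⇒ K₋ = 0.5(G₋ + δ_{+∞})`
as `v ↓ -∞`, and `π(v, -v+dx) ⇒ K₋` as `v ↑ +∞`, `⇒ K₊` as `v ↓ -∞`. -/
theorem extreme_events_arch_laplace
    (θ0 θ1 κ c : ℝ) (hθ0 : 0 < θ0) (hθ1 : θ1 ∈ Set.Ioo (0 : ℝ) 1) (hκ : 0 < κ) (hc : 0 < c)
    (Finf : ℝ → ℝ) (hFcont : Continuous Finf) (hFmono : Monotone Finf)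
    (hFtop : Tendsto Finf atTop (𝓝 1)) (hFbot : Tendsto Finf atBot (𝓝 0))
    (hFsymm : ∀ x : ℝ, 1 - Finf x = Finf (-x))
    (hFtail : Tendsto (fun x => (1 - Finf x) / (c * x ^ (-κ))) atTop (𝓝 1)) :
    ∀ y : ℝ,
      (Tendsto (fun v => archKernel θ0 θ1 Finf v (v + y)) atTop
        (𝓝 (0.5 + 0.5 * archGplus θ1 κ y))) ∧
      (Tendsto (fun v => archKernel θ0 θ1 Finf v (v + y)) atBot
        (𝓝 (0.5 * archGminus θ1 κ y))) ∧
      (Tendsto (fun v => archKernel θ0 θ1 Finf v (-v + y)) atTop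
        (𝓝 (0.5 * archGminus θ1 κ y))) ∧
      (Tendsto (fun v => archKernel θ0 θ1 Finf v (-v + y)) atBot
        (𝓝 (0.5 + 0.5 * archGplus θ1 κ y))) := by
  intro y
  set Q : ℝ → ℝ := fun u => genInv Finf (laplaceCDF u)
  set A : ℝ := (2 * c) ^ (1 / κ)
  have hApos : 0 < A := Real.rpow_pos_of_pos (by positivity) _
  have hFQ : ∀ u, Finf (Q u) = laplaceCDF u := fun u =>
    apply_genInv hFcont hFmono hFtop hFbot (laplaceCDF_pos u) (laplaceCDF_lt_one u)
  have hQtop : Tendsto (fun u => Q u * Real.exp (-u / κ)) atTop (𝓝 A) :=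
    tendsto_transport_mul_exp hκ hc hFmono hFtail hFQ
  have hQbot : Tendsto (fun u => Q u * Real.exp (u / κ)) atBot (𝓝 (-A)) := by
    have h := tendsto_transport_mul_exp hκ hc hFmono hFtail (R := fun u => -Q (-u)) fun u => by
      rw [← hFsymm, hFQ, one_sub_laplaceCDF, neg_neg]
    refine (h.comp tendsto_neg_atBot_atTop).neg.congr fun u => ?_
    simp
  have hrtop : Tendsto (fun v : ℝ => Real.exp (-v / κ)) atTop (𝓝 0) :=
    Real.tendsto_exp_atBot.comp (tendsto_neg_atTop_atBot.atBot_div_const hκ)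
  have hrbot : Tendsto (fun v : ℝ => Real.exp (v / κ)) atBot (𝓝 0) :=
    Real.tendsto_exp_atBot.comp (tendsto_id.atBot_div_const hκ)
  have hplus : 0.5 + 0.5 * archGplus θ1 κ y =
      stdNormalCDF (A * Real.exp (y / κ) / (Real.sqrt θ1 * A)) := by
    rw [mul_comm A, mul_div_mul_right _ _ hApos.ne', archGplus]
    ring
  have hminus : 0.5 * archGminus θ1 κ y =
      stdNormalCDF (-A * Real.exp (-y / κ) / (Real.sqrt θ1 * A)) := by
    rw [neg_mul, ← mul_neg, mul_comm A, mul_div_mul_right _ _ hApos.ne', archGminus]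
    ring
  have hkernel : ∀ {l : Filter ℝ} {r g : ℝ → ℝ} {n d : ℝ}, |d| = A → (∀ v, 0 < r v) →
      Tendsto r l (𝓝 0) → Tendsto (fun v => Q (g v) * r v) l (𝓝 n) →
      Tendsto (fun v => Q v * r v) l (𝓝 d) →
      Tendsto (fun v => archKernel θ0 θ1 Finf v (g v)) l
        (𝓝 (stdNormalCDF (n / (Real.sqrt θ1 * A)))) := by
    intro l r g n d hd hr hr0 hN hD
    have hd0 : d ≠ 0 := abs_pos.mp (hd ▸ hApos)
    have h := tendsto_div_sqrt_add_mul_sq (a := θ0) hθ1.1 hd0 hr hr0 hN hD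
    rw [hd] at h
    exact (continuous_stdNormalCDF.tendsto _).comp h
  have habs : |A| = A := abs_of_pos hApos
  have habs' : |-A| = A := by rw [abs_neg, habs]
  rw [hplus, hminus]
  refine ⟨hkernel habs (fun v => Real.exp_pos _) hrtop ?_ hQtop,
    hkernel habs' (fun v => Real.exp_pos _) hrbot ?_ hQbot,
    hkernel habs (fun v => Real.exp_pos _) hrtop ?_ hQtop,
    hkernel habs' (fun v => Real.exp_pos _) hrbot ?_ hQbot⟩
  · refine ((hQtop.comp (tendsto_atTop_add_const_right _ y tendsto_id)).mul_const
      (Real.exp (y / κ))).congr fun v => ?_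
    simp only [Function.comp_apply, id, mul_assoc, ← Real.exp_add]
    ring_nf
  · refine ((hQbot.comp (tendsto_atBot_add_const_right _ y tendsto_id)).mul_const
      (Real.exp (-y / κ))).congr fun v => ?_
    simp only [Function.comp_apply, id, mul_assoc, ← Real.exp_add]
    ring_nf
  · refine ((hQbot.comp (tendsto_atBot_add_const_right _ y tendsto_neg_atTop_atBot)).mul_const
      (Real.exp (-y / κ))).congr fun v => ?_
    simp only [Function.comp_apply, mul_assoc, ← Real.exp_add]
    ring_nf
  · refine ((hQtop.comp (tendsto_atTop_add_const_right _ y tendsto_neg_atBot_atTop)).mul_const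
      (Real.exp (y / κ))).congr fun v => ?_
    simp only [Function.comp_apply, mul_assoc, ← Real.exp_add]
    ring_nf
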